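/- arXiv:2410.19501 — 2 statements merged into one kernel-verified Lean document; each statement's English description precedes it below -/
import Mathlib

section
/- Let m ≥ 1 and equip ℝ^m with the standard inner product ⟨·,·⟩ and the induced Euclidean norm ‖·‖. Let P, T ∈ ℝ^m with P ≠ 0 and let r ≥ 0 satisfy ‖P − T‖ ≤ r. For Q ∈ ℝ^m define χ_P(Q) := ⟨Q, −P/‖P‖⟩, so that χ_P(P) = −‖P‖. Let h > 0 be such that χ_P(T) ≥ χ_P(P) + h, and let ν ∈ [0, h). If ‖P‖ ≥ max{(r² − ν²)/(2(h − ν)), h}, then ‖T‖ ≤ ‖P‖ − ν. -/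
open RealInnerProductSpace

/-- **Norm bound from a `χ_P`-bound** (euclidean geometry lemma). Writing
`χ_P(Q) = ⟪Q, -P/‖P‖⟫` (so `χ_P(P) = -‖P‖`), if `‖P - T‖ ≤ r`, `P ≠ 0`,
`χ_P(T) ≥ χ_P(P) + h` with `h > 0`, `ν ∈ [0, h)` and
`‖P‖ ≥ max ((r² - ν²)/(2(h - ν))) h`, then `‖T‖ ≤ ‖P‖ - ν`. -/
theorem stmt_11 (m : ℕ) (hm : 1 ≤ m) (P T : EuclideanSpace ℝ (Fin m))
    (hP : P ≠ 0) (r : ℝ) (hr : 0 ≤ r) (hPT : ‖P - T‖ ≤ r)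
    (h : ℝ) (hh : 0 < h)
    (hchi : ⟪T, -(‖P‖⁻¹ • P)⟫ ≥ ⟪P, -(‖P‖⁻¹ • P)⟫ + h)
    (ν : ℝ) (hν0 : 0 ≤ ν) (hνh : ν < h)
    (hnorm : max ((r ^ 2 - ν ^ 2) / (2 * (h - ν))) h ≤ ‖P‖) :
    ‖T‖ ≤ ‖P‖ - ν := by
  have hp : 0 < ‖P‖ := norm_pos_iff.mpr hP
  have h1 := (le_max_left _ _).trans hnorm
  have h2 := (le_max_right _ _).trans hnorm
  rw [div_le_iff₀ (by linarith)] at h1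
  rw [inner_neg_right, inner_neg_right, inner_smul_right, inner_smul_right,
    real_inner_self_eq_norm_sq] at hchi
  have e1 : ‖P‖⁻¹ * ‖P‖ ^ 2 = ‖P‖ := by field_simp
  have e2 : ⟪T, P⟫ = ‖P‖ * (‖P‖⁻¹ * ⟪T, P⟫) := by field_simp
  rw [e1] at hchi
  have h3 : ⟪T, P⟫ ≤ ‖P‖ * (‖P‖ - h) := by
    rw [e2]
    exact mul_le_mul_of_nonneg_left (by linarith) hp.le
  have h4 := norm_sub_sq_real P T
  rw [real_inner_comm] at h4
  have h5 : ‖P - T‖ ^ 2 ≤ r ^ 2 := pow_le_pow_left₀ (norm_nonneg _) hPT 2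
  refine (sq_le_sq₀ (norm_nonneg _) (by linarith)).mp ?_
  nlinarith
end

section
/- Let α be a set and χ : α → ℝ a function. Suppose ρ and ρ' are words over α that are freely equivalent and both have non-negative χ-track. Then there is a finite sequence ρ = w₀, w₁, …, w_N = ρ' of words such that each w_{j+1} is obtained from w_j by a single elementary insertion or deletion of an adjacent canceling pair of letters (a,ε)(a,−ε), and every intermediate word w_j has non-negative χ-track. -/
/-- The value of a letter `(a, ε)`: `χ a` if the exponent is `+1` (`true`), and
`-χ a` if it is `-1` (`false`). -/
def letterVal {α : Type*} (χ : α → ℝ) (l : α × Bool) : ℝ :=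
  if l.2 then χ l.1 else -χ l.1

/-- A word over `α` has non-negative `χ`-track if every partial sum of the values of
its letters over its prefixes is `≥ 0`. -/
def NonnegTrack {α : Type*} (χ : α → ℝ) (w : List (α × Bool)) : Prop :=
  ∀ n : ℕ, 0 ≤ ((w.take n).map (letterVal χ)).sum

theorem nonnegTrack_step {α : Type*} (χ : α → ℝ) {w w' : List (α × Bool)}
    (h : FreeGroup.Red.Step w w') (hw : NonnegTrack χ w) : NonnegTrack χ w' := by
  cases h with
  | @not L₁ L₂ x b =>
    intro n
    by_cases hn : n ≤ L₁.length
    · have := hw n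
      rwa [List.take_append_of_le_length hn] at this ⊢
    · obtain ⟨k, rfl⟩ := Nat.exists_eq_add_of_le (not_le.mp hn).le
      have := hw (L₁.length + (k + 2))
      rw [List.take_length_add_append] at this ⊢
      cases b <;> simpa [letterVal] using this

/-- **Free equivalence of words of non-negative track.** If `ρ` and `ρ'` are freely
equivalent words of non-negative `χ`-track, then they are connected by a chain of
elementary insertions/deletions of adjacent canceling pairs all of whose intermediate
words have non-negative `χ`-track. -/
theorem stmt_12 {α : Type*} (χ : α → ℝ) (ρ ρ' : List (α × Bool))
    (hequiv : FreeGroup.mk ρ = FreeGroup.mk ρ')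
    (hρ : NonnegTrack χ ρ) (hρ' : NonnegTrack χ ρ') :
    Relation.ReflTransGen
      (fun w w' => (FreeGroup.Red.Step w w' ∨ FreeGroup.Red.Step w' w) ∧
        NonnegTrack χ w') ρ ρ' := by
  obtain ⟨c, h1, h2⟩ := FreeGroup.Red.exact.1 hequiv
  have key : ∀ {w c : List (α × Bool)}, FreeGroup.Red w c → NonnegTrack χ w →
      NonnegTrack χ c ∧
      Relation.ReflTransGen (fun w w' => (FreeGroup.Red.Step w w' ∨ FreeGroup.Red.Step w' w) ∧
        NonnegTrack χ w') w c ∧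
      Relation.ReflTransGen (fun w w' => (FreeGroup.Red.Step w w' ∨ FreeGroup.Red.Step w' w) ∧
        NonnegTrack χ w') c w := by
    intro w c h hw
    induction h with
    | refl => exact ⟨hw, .refl, .refl⟩
    | tail _ hs ih =>
      have hc := nonnegTrack_step χ hs ih.1
      exact ⟨hc, ih.2.1.tail ⟨Or.inl hs, hc⟩, ih.2.2.head ⟨Or.inr hs, ih.1⟩⟩
  exact (key h1 hρ).2.1.trans (key h2 hρ').2.2
end
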